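/- Let τ ∈ [0, 1/2) and let g : ℝ⁴ → ℝ be twice continuously differentiable. Let R₄(h) denote the error of the four-dimensional quadrature of the paper applied to g over the simplex {h ≥ η₁ ≥ η₂ ≥ η₃ ≥ η₄ ≥ 0} (the exact quadruple integral minus the pure function-value quadrature of equation (A.4)). Define R_a(τ) := (248832τ⁷ − 732672τ⁶ + 891648τ⁵ − 578880τ⁴ + 216000τ³ − 46416τ² + 5376τ − 269)/(155520(2τ−1)⁷) and R_b(τ) := (27648τ⁷ − 96768τ⁶ + 145152τ⁵ − 118080τ⁴ + 54720τ³ − 14064τ² + 1824τ − 91)/(51840(2τ−1)⁷). Then R₄(h) − h⁵·R_a(τ)·( ∂₁g(0,0,0,0) − ∂₄g(0,0,0,0) ) − h⁵·R_b(τ)·( ∂₂g(0,0,0,0) − ∂₃g(0,0,0,0) ) = O(h⁶) as h → 0⁺. -/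

import Mathlib

open Asymptotics

/-- Partial derivative in the first variable of a function of four real variables. -/
noncomputable def pd1 (g : ℝ → ℝ → ℝ → ℝ → ℝ) : ℝ → ℝ → ℝ → ℝ → ℝ :=
  fun x y z w => deriv (fun s => g s y z w) x

/-- Partial derivative in the second variable. -/
noncomputable def pd2 (g : ℝ → ℝ → ℝ → ℝ → ℝ) : ℝ → ℝ → ℝ → ℝ → ℝ :=
  fun x y z w => deriv (fun s => g x s z w) y

/-- Partial derivative in the third variable. -/
noncomputable def pd3 (g : ℝ → ℝ → ℝ → ℝ → ℝ) : ℝ → ℝ → ℝ → ℝ → ℝ :=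
  fun x y z w => deriv (fun s => g x y s w) z

/-- Partial derivative in the fourth variable. -/
noncomputable def pd4 (g : ℝ → ℝ → ℝ → ℝ → ℝ) : ℝ → ℝ → ℝ → ℝ → ℝ :=
  fun x y z w => deriv (fun s => g x y z s) w

/-- The error of the four-dimensional quadrature of the paper (equation (A.4))
over the simplex `{h ≥ η₁ ≥ η₂ ≥ η₃ ≥ η₄ ≥ 0}`: the exact quadruple integral
minus the pure function-value quadrature with nodes in `{c, m, a}` =
`{(1−τ)h, h/2, τh}` and weights `v₁^{j₁}v₂^{j₂}v₃^{j₃}/(j₁!j₂!j₃!)`,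
`v₁ = v₃ = p`, `v₂ = q`. -/
noncomputable def R₄ (τ : ℝ) (g : ℝ → ℝ → ℝ → ℝ → ℝ) (h : ℝ) : ℝ :=
  let p := 1 / (6 * (1 - 2*τ)^2)
  let q := 1 - 2*p
  let a := τ*h
  let m := h/2
  let c := (1-τ)*h
  (∫ η₁ in (0:ℝ)..h, ∫ η₂ in (0:ℝ)..η₁, ∫ η₃ in (0:ℝ)..η₂, ∫ η₄ in (0:ℝ)..η₃,
      g η₁ η₂ η₃ η₄) -
    h^4 * (p^4/24    * g c c c c
         + p^3*q/6   * g c c c m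
         + p^4/6     * g c c c a
         + p^2*q^2/4 * g c c m m
         + p^3*q/2   * g c c m a
         + p^4/4     * g c c a a
         + p*q^3/6   * g c m m m
         + p^2*q^2/2 * g c m m a
         + p^3*q/2   * g c m a a
         + p^4/6     * g c a a a
         + q^4/24    * g m m m m
         + p*q^3/6   * g m m m a
         + p^2*q^2/4 * g m m a a
         + p^3*q/6   * g m a a a
         + p^4/24    * g a a a a)

/-- The iterated integral of `g` over the ordered simplex of size `h`. -/
noncomputable def simplexIntegral (g : ℝ → ℝ → ℝ → ℝ → ℝ) (h : ℝ) : ℝ :=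
  ∫ η₁ in (0:ℝ)..h, ∫ η₂ in (0:ℝ)..η₁, ∫ η₃ in (0:ℝ)..η₂, ∫ η₄ in (0:ℝ)..η₃, g η₁ η₂ η₃ η₄

theorem simplexIntegral_add {f g : ℝ → ℝ → ℝ → ℝ → ℝ}
    (hf : Continuous fun v : ℝ × ℝ × ℝ × ℝ => f v.1 v.2.1 v.2.2.1 v.2.2.2)
    (hg : Continuous fun v : ℝ × ℝ × ℝ × ℝ => g v.1 v.2.1 v.2.2.1 v.2.2.2) (h : ℝ) :
    simplexIntegral (fun x y z w => f x y z w + g x y z w) h =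
      simplexIntegral f h + simplexIntegral g h := by
  have step {X : Type} [TopologicalSpace X] {s : X → ℝ} {F : X → ℝ → ℝ} (hs : Continuous s)
      (hF : Continuous fun p : X × ℝ => F p.1 p.2) :
      Continuous fun x => ∫ t in (0:ℝ)..s x, F x t :=
    intervalIntegral.continuous_parametric_intervalIntegral_of_continuous hF hs
  have cont4 {g : ℝ → ℝ → ℝ → ℝ → ℝ}
      (hg : Continuous fun v : ℝ × ℝ × ℝ × ℝ => g v.1 v.2.1 v.2.2.1 v.2.2.2) (x y z : ℝ) :
      Continuous fun w => g x y z w :=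
    hg.comp (by fun_prop : Continuous fun w : ℝ => (x, y, z, w))
  have cont3 {g : ℝ → ℝ → ℝ → ℝ → ℝ}
      (hg : Continuous fun v : ℝ × ℝ × ℝ × ℝ => g v.1 v.2.1 v.2.2.1 v.2.2.2) :
      Continuous fun v : ℝ × ℝ × ℝ => ∫ w in (0:ℝ)..v.2.2, g v.1 v.2.1 v.2.2 w :=
    step (F := fun v : ℝ × ℝ × ℝ => g v.1 v.2.1 v.2.2) (by fun_prop)
      (hg.comp (by fun_prop : Continuous fun p : (ℝ × ℝ × ℝ) × ℝ =>
        (p.1.1, p.1.2.1, p.1.2.2, p.2)))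
  have cont2 {g : ℝ → ℝ → ℝ → ℝ → ℝ}
      (hg : Continuous fun v : ℝ × ℝ × ℝ × ℝ => g v.1 v.2.1 v.2.2.1 v.2.2.2) :
      Continuous fun v : ℝ × ℝ => ∫ z in (0:ℝ)..v.2, ∫ w in (0:ℝ)..z, g v.1 v.2 z w :=
    step (F := fun (v : ℝ × ℝ) z => ∫ w in (0:ℝ)..z, g v.1 v.2 z w) (by fun_prop)
      ((cont3 hg).comp (by fun_prop : Continuous fun p : (ℝ × ℝ) × ℝ => (p.1.1, p.1.2, p.2)))
  have cont1 {g : ℝ → ℝ → ℝ → ℝ → ℝ}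
      (hg : Continuous fun v : ℝ × ℝ × ℝ × ℝ => g v.1 v.2.1 v.2.2.1 v.2.2.2) :
      Continuous fun x => ∫ y in (0:ℝ)..x, ∫ z in (0:ℝ)..y, ∫ w in (0:ℝ)..z, g x y z w :=
    step (F := fun x y => ∫ z in (0:ℝ)..y, ∫ w in (0:ℝ)..z, g x y z w) (by fun_prop) (cont2 hg)
  have e4 (x y z : ℝ) : ∫ w in (0:ℝ)..z, (f x y z w + g x y z w) =
      (∫ w in (0:ℝ)..z, f x y z w) + ∫ w in (0:ℝ)..z, g x y z w :=
    intervalIntegral.integral_add ((cont4 hf x y z).intervalIntegrable _ _)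
      ((cont4 hg x y z).intervalIntegrable _ _)
  have m3 (x y : ℝ) : Continuous fun z : ℝ => (x, y, z) := by fun_prop
  have m2 (x : ℝ) : Continuous fun y : ℝ => (x, y) := by fun_prop
  have e3 (x y : ℝ) := intervalIntegral.integral_add (μ := MeasureTheory.volume)
    (((cont3 hf).comp (m3 x y)).intervalIntegrable 0 y)
    (((cont3 hg).comp (m3 x y)).intervalIntegrable 0 y)
  have e2 (x : ℝ) := intervalIntegral.integral_add (μ := MeasureTheory.volume)
    (((cont2 hf).comp (m2 x)).intervalIntegrable 0 x)
    (((cont2 hg).comp (m2 x)).intervalIntegrable 0 x)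
  have e1 := intervalIntegral.integral_add (μ := MeasureTheory.volume)
    ((cont1 hf).intervalIntegrable 0 h) ((cont1 hg).intervalIntegrable 0 h)
  simp only [Function.comp_def] at e3 e2
  simp only [simplexIntegral, e4, e3, e2, e1]

theorem abs_simplexIntegral_le {g : ℝ → ℝ → ℝ → ℝ → ℝ} {h K : ℝ} (hh : 0 ≤ h) (hK : 0 ≤ K)
    (hg : ∀ x ∈ Set.Icc 0 h, ∀ y ∈ Set.Icc 0 h, ∀ z ∈ Set.Icc 0 h, ∀ w ∈ Set.Icc 0 h,
      |g x y z w| ≤ K) :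
    |simplexIntegral g h| ≤ K * h ^ 4 := by
  have step {F : ℝ → ℝ} {M x : ℝ} (hM : 0 ≤ M) (hx : x ∈ Set.Icc 0 h)
      (hF : ∀ t ∈ Set.Icc 0 h, |F t| ≤ M) : |∫ t in (0:ℝ)..x, F t| ≤ M * h := by
    have key : ‖∫ t in (0:ℝ)..x, F t‖ ≤ M * |x - 0| := by
      refine intervalIntegral.norm_integral_le_of_norm_le_const fun t ht => ?_
      rw [Set.uIoc_of_le hx.1] at ht
      exact hF t ⟨ht.1.le, ht.2.trans hx.2⟩
    rw [Real.norm_eq_abs, sub_zero, abs_of_nonneg hx.1] at key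
    exact key.trans (mul_le_mul_of_nonneg_left hx.2 hM)
  have hmem : h ∈ Set.Icc 0 h := ⟨hh, le_rfl⟩
  rw [show K * h ^ 4 = K * h * h * h * h by ring]
  exact step (by positivity) hmem fun x hx => step (by positivity) hx fun y hy =>
    step (by positivity) hy fun z hz => step hK hz fun w hw => hg x hx y hy z hz w hw

theorem integral_quartic (a b c d e x : ℝ) :
    ∫ t in (0:ℝ)..x, (a + b * t + c * t ^ 2 + d * t ^ 3 + e * t ^ 4) =
      a * x + b * x ^ 2 / 2 + c * x ^ 3 / 3 + d * x ^ 4 / 4 + e * x ^ 5 / 5 := by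
  have hderiv (t : ℝ) : HasDerivAt
      (fun x : ℝ => a * x + b * x ^ 2 / 2 + c * x ^ 3 / 3 + d * x ^ 4 / 4 + e * x ^ 5 / 5)
      (a + b * t + c * t ^ 2 + d * t ^ 3 + e * t ^ 4) t := by
    refine ((((((hasDerivAt_id t).const_mul a).add
      (((hasDerivAt_pow 2 t).const_mul b).div_const 2)).add
      (((hasDerivAt_pow 3 t).const_mul c).div_const 3)).add
      (((hasDerivAt_pow 4 t).const_mul d).div_const 4)).add
      (((hasDerivAt_pow 5 t).const_mul e).div_const 5)).congr_deriv ?_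
    norm_num
    ring
  rw [intervalIntegral.integral_eq_sub_of_hasDerivAt (fun t _ => hderiv t)
    (Continuous.intervalIntegrable (by fun_prop) _ _)]
  ring

theorem simplexIntegral_affine (a b c d e h : ℝ) :
    simplexIntegral (fun x y z w => a + b * x + c * y + d * z + e * w) h =
      a * h ^ 4 / 24 + h ^ 5 * (4 * b + 3 * c + 2 * d + e) / 120 := by
  have e4 (x y z : ℝ) : ∫ w in (0:ℝ)..z, (a + b * x + c * y + d * z + e * w) =
      0 + (a + b * x + c * y) * z + (d + e / 2) * z ^ 2 + 0 * z ^ 3 + 0 * z ^ 4 := by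
    have := integral_quartic (a + b * x + c * y + d * z) e 0 0 0 z
    simp only [zero_mul, add_zero] at this
    rw [this]; ring
  have e3 (x y : ℝ) : ∫ z in (0:ℝ)..y, ∫ w in (0:ℝ)..z, (a + b * x + c * y + d * z + e * w) =
      0 + 0 * y + (a + b * x) / 2 * y ^ 2 + (c / 2 + (d + e / 2) / 3) * y ^ 3 + 0 * y ^ 4 := by
    simp only [e4, integral_quartic]; ring
  have e2 (x : ℝ) : ∫ y in (0:ℝ)..x, ∫ z in (0:ℝ)..y, ∫ w in (0:ℝ)..z,
      (a + b * x + c * y + d * z + e * w) = 0 + 0 * x + 0 * x ^ 2 + a / 6 * x ^ 3 +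
        (b / 6 + (c / 2 + (d + e / 2) / 3) / 4) * x ^ 4 := by
    simp only [e3, integral_quartic]; ring
  simp only [simplexIntegral, e2, integral_quartic]
  ring

theorem R₄_add {f g : ℝ → ℝ → ℝ → ℝ → ℝ}
    (hf : Continuous fun v : ℝ × ℝ × ℝ × ℝ => f v.1 v.2.1 v.2.2.1 v.2.2.2)
    (hg : Continuous fun v : ℝ × ℝ × ℝ × ℝ => g v.1 v.2.1 v.2.2.1 v.2.2.2) (τ h : ℝ) :
    R₄ τ (fun x y z w => f x y z w + g x y z w) h = R₄ τ f h + R₄ τ g h := by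
  have key := simplexIntegral_add hf hg h
  simp only [simplexIntegral] at key
  simp only [R₄, key]
  ring

theorem R₄_affine {τ : ℝ} (hτ : 2 * τ - 1 ≠ 0) (a b c d e h : ℝ) :
    R₄ τ (fun x y z w => a + b * x + c * y + d * z + e * w) h =
      h ^ 5 * ((248832*τ^7 - 732672*τ^6 + 891648*τ^5 - 578880*τ^4 + 216000*τ^3
        - 46416*τ^2 + 5376*τ - 269) / (155520 * (2*τ - 1)^7)) * (b - e) +
      h ^ 5 * ((27648*τ^7 - 96768*τ^6 + 145152*τ^5 - 118080*τ^4 + 54720*τ^3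
        - 14064*τ^2 + 1824*τ - 91) / (51840 * (2*τ - 1)^7)) * (c - d) := by
  have key := simplexIntegral_affine a b c d e h
  simp only [simplexIntegral] at key
  simp only [R₄, key]
  obtain ⟨s, hs⟩ : ∃ s, s = 2 * τ - 1 := ⟨_, rfl⟩
  obtain rfl : τ = (1 + s) / 2 := by linarith
  rw [← hs] at hτ ⊢
  rw [show 1 - 2 * ((1 + s) / 2) = -s by ring]
  field_simp
  ring

theorem R₄_isBigO (τ : ℝ) {g : ℝ → ℝ → ℝ → ℝ → ℝ}
    (hg : (fun v : ℝ × ℝ × ℝ × ℝ => g v.1 v.2.1 v.2.2.1 v.2.2.2) =O[nhds 0]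
      fun v => ‖v‖ ^ 2) :
    R₄ τ g =O[nhdsWithin 0 (Set.Ioi 0)] fun h : ℝ => h ^ 6 := by
  have node (a b c d : ℝ) : (fun h : ℝ => g (a * h) (b * h) (c * h) (d * h))
      =O[nhdsWithin 0 (Set.Ioi 0)] fun h : ℝ => h ^ 2 := by
    have ht : Filter.Tendsto (fun h : ℝ => h • (a, b, c, d)) (nhdsWithin 0 (Set.Ioi 0))
        (nhds 0) := by
      have : Continuous fun h : ℝ => h • (a, b, c, d) := by fun_prop
      simpa using (this.tendsto 0).mono_left nhdsWithin_le_nhds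
    have h1 := hg.comp_tendsto ht
    have h2 : ((fun v : ℝ × ℝ × ℝ × ℝ => ‖v‖ ^ 2) ∘ fun h : ℝ => h • (a, b, c, d))
        =O[nhdsWithin 0 (Set.Ioi 0)] fun h : ℝ => h ^ 2 := by
      refine IsBigO.of_bound (‖(a, b, c, d)‖ ^ 2) (Filter.Eventually.of_forall fun h => ?_)
      simp only [Function.comp_apply, norm_smul, mul_pow, norm_mul, norm_pow, norm_norm]
      exact (mul_comm _ _).le
    refine (h1.trans h2).congr_left fun h => ?_
    simp [mul_comm]
  have hint : simplexIntegral g =O[nhdsWithin 0 (Set.Ioi 0)] fun h : ℝ => h ^ 6 := by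
    obtain ⟨C, hC0, hC⟩ := hg.exists_nonneg
    obtain ⟨δ, hδ, hb⟩ := Metric.eventually_nhds_iff.1 hC.bound
    refine IsBigO.of_bound C ?_
    filter_upwards [Ioo_mem_nhdsGT hδ] with h hh
    have hle := abs_simplexIntegral_le (g := g) (K := C * h ^ 2) hh.1.le (by positivity)
      fun x hx y hy z hz w hw => by
        have hn : ‖(x, y, z, w)‖ ≤ h := by
          simp only [Prod.norm_mk, Real.norm_eq_abs, sup_le_iff]
          exact ⟨abs_le.2 ⟨by linarith [hx.1, hh.1], hx.2⟩,
            abs_le.2 ⟨by linarith [hy.1, hh.1], hy.2⟩,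
            abs_le.2 ⟨by linarith [hz.1, hh.1], hz.2⟩,
            abs_le.2 ⟨by linarith [hw.1, hh.1], hw.2⟩⟩
        have := hb (y := (x, y, z, w)) (by simpa using hn.trans_lt hh.2)
        simp only [Real.norm_eq_abs, abs_pow, abs_norm] at this
        exact this.trans (by gcongr)
    simp only [Real.norm_eq_abs, abs_pow, abs_of_pos hh.1]
    exact hle.trans_eq (by ring)
  have hc (h : ℝ) : h ^ 6 = h ^ 4 * h ^ 2 := by ring
  refine IsBigO.sub hint ?_
  simp only [div_eq_inv_mul, hc]
  refine (isBigO_refl _ _).mul ?_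
  repeat' apply IsBigO.add
  all_goals exact (node _ _ _ _).const_mul_left _

theorem taylor_one_isBigO {E F : Type*} [NormedAddCommGroup E] [NormedSpace ℝ E]
    [NormedAddCommGroup F] [NormedSpace ℝ F] {f : E → F} (hf : ContDiff ℝ 2 f) (x : E) :
    (fun v => f (x + v) - f x - fderiv ℝ f x v) =O[nhds 0] fun v => ‖v‖ ^ 2 := by
  have hd : ContDiff ℝ 1 (fderiv ℝ f) := hf.fderiv_right (by norm_num)
  obtain ⟨K, t, ht, hK⟩ := hd.contDiffAt.exists_lipschitzOnWith (x := x)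
  obtain ⟨δ, hδ, hball⟩ := Metric.mem_nhds_iff.1 ht
  refine IsBigO.of_bound K ?_
  filter_upwards [Metric.ball_mem_nhds (0 : E) hδ] with v hv
  have hv : ‖v‖ < δ := by simpa using hv
  have hmem : x + v ∈ Metric.closedBall x ‖v‖ := by simp
  have key := (convex_closedBall x ‖v‖).norm_image_sub_le_of_norm_hasFDerivWithin_le'
    (f := f) (f' := fderiv ℝ f) (φ := fderiv ℝ f x) (C := K * ‖v‖)
    (fun y _ => ((hf.differentiable (by norm_num)) y).hasFDerivAt.hasFDerivWithinAt)
    (fun y hy => ?_) (Metric.mem_closedBall_self (norm_nonneg v)) hmem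
  · simp only [add_sub_cancel_left] at key
    simpa [pow_two, mul_assoc] using key
  · have hy' : ‖y - x‖ ≤ ‖v‖ := by simpa [dist_eq_norm] using hy
    have := hK.norm_sub_le (hball (show y ∈ Metric.ball x δ by
      rw [Metric.mem_ball, dist_eq_norm]; exact hy'.trans_lt hv))
      (hball (Metric.mem_ball_self hδ))
    exact this.trans (by gcongr)

theorem R4_dominant_term
    (τ : ℝ) (hτ : τ ∈ Set.Ico (0:ℝ) (1/2))
    (g : ℝ → ℝ → ℝ → ℝ → ℝ)
    (hg : ContDiff ℝ 2 (fun v : ℝ × ℝ × ℝ × ℝ => g v.1 v.2.1 v.2.2.1 v.2.2.2))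
    (Ra Rb : ℝ)
    (hRa : Ra = (248832*τ^7 - 732672*τ^6 + 891648*τ^5 - 578880*τ^4 + 216000*τ^3
        - 46416*τ^2 + 5376*τ - 269) / (155520 * (2*τ - 1)^7))
    (hRb : Rb = (27648*τ^7 - 96768*τ^6 + 145152*τ^5 - 118080*τ^4 + 54720*τ^3
        - 14064*τ^2 + 1824*τ - 91) / (51840 * (2*τ - 1)^7)) :
    (fun h : ℝ =>
      R₄ τ g h
      - h^5 * Ra * (pd1 g 0 0 0 0 - pd4 g 0 0 0 0)
      - h^5 * Rb * (pd2 g 0 0 0 0 - pd3 g 0 0 0 0))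
      =O[nhdsWithin 0 (Set.Ioi 0)] fun h : ℝ => h^6 := by
  have hne : 2 * τ - 1 ≠ 0 := by linarith [hτ.2]
  set G : ℝ × ℝ × ℝ × ℝ → ℝ := fun v => g v.1 v.2.1 v.2.2.1 v.2.2.2 with hG
  have hGd : HasFDerivAt G (fderiv ℝ G 0) (0, 0, 0, 0) :=
    ((hg.differentiable (by norm_num)) 0).hasFDerivAt
  have h1 : pd1 g 0 0 0 0 = fderiv ℝ G 0 (1, 0, 0, 0) :=
    (hGd.comp_hasDerivAt (f := fun s : ℝ => (s, (0:ℝ), (0:ℝ), (0:ℝ))) 0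
      ((hasDerivAt_id _).prodMk (hasDerivAt_const _ _))).deriv
  have h2 : pd2 g 0 0 0 0 = fderiv ℝ G 0 (0, 1, 0, 0) :=
    (hGd.comp_hasDerivAt (f := fun s : ℝ => ((0:ℝ), s, (0:ℝ), (0:ℝ))) 0
      ((hasDerivAt_const _ _).prodMk ((hasDerivAt_id _).prodMk (hasDerivAt_const _ _)))).deriv
  have h3 : pd3 g 0 0 0 0 = fderiv ℝ G 0 (0, 0, 1, 0) :=
    (hGd.comp_hasDerivAt (f := fun s : ℝ => ((0:ℝ), (0:ℝ), s, (0:ℝ))) 0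
      ((hasDerivAt_const _ _).prodMk ((hasDerivAt_const _ _).prodMk
        ((hasDerivAt_id _).prodMk (hasDerivAt_const _ _))))).deriv
  have h4 : pd4 g 0 0 0 0 = fderiv ℝ G 0 (0, 0, 0, 1) :=
    (hGd.comp_hasDerivAt (f := fun s : ℝ => ((0:ℝ), (0:ℝ), (0:ℝ), s)) 0
      ((hasDerivAt_const _ _).prodMk ((hasDerivAt_const _ _).prodMk
        ((hasDerivAt_const _ _).prodMk (hasDerivAt_id _))))).deriv
  have hlin (x y z w : ℝ) : fderiv ℝ G 0 (x, y, z, w) = pd1 g 0 0 0 0 * x +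
      pd2 g 0 0 0 0 * y + pd3 g 0 0 0 0 * z + pd4 g 0 0 0 0 * w := by
    have : (x, y, z, w) = x • ((1, 0, 0, 0) : ℝ × ℝ × ℝ × ℝ) + y • (0, 1, 0, 0) +
        z • (0, 0, 1, 0) + w • (0, 0, 0, 1) := by simp
    rw [this, map_add, map_add, map_add, map_smul, map_smul, map_smul, map_smul,
      ← h1, ← h2, ← h3, ← h4]
    simp only [smul_eq_mul]
    ring
  set L : ℝ → ℝ → ℝ → ℝ → ℝ := fun x y z w => g 0 0 0 0 + pd1 g 0 0 0 0 * x +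
    pd2 g 0 0 0 0 * y + pd3 g 0 0 0 0 * z + pd4 g 0 0 0 0 * w with hL
  set r : ℝ → ℝ → ℝ → ℝ → ℝ := fun x y z w => g x y z w - L x y z w with hr
  have hLc : Continuous fun v : ℝ × ℝ × ℝ × ℝ => L v.1 v.2.1 v.2.2.1 v.2.2.2 := by
    simp only [hL]; fun_prop
  have hrc : Continuous fun v : ℝ × ℝ × ℝ × ℝ => r v.1 v.2.1 v.2.2.1 v.2.2.2 :=
    hg.continuous.sub hLc
  have hrO : (fun v : ℝ × ℝ × ℝ × ℝ => r v.1 v.2.1 v.2.2.1 v.2.2.2) =O[nhds 0]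
      fun v => ‖v‖ ^ 2 := by
    refine (taylor_one_isBigO hg 0).congr_left fun v => ?_
    obtain ⟨x, y, z, w⟩ := v
    rw [hlin]
    simp only [hr, hL, hG, zero_add, Prod.fst_zero, Prod.snd_zero]
    ring
  refine (R₄_isBigO τ hrO).congr_left fun h => ?_
  have hsum := R₄_add hLc hrc τ h
  have hgr : (fun x y z w => L x y z w + r x y z w) = g := by
    funext x y z w; simp only [hr]; ring
  rw [hgr, R₄_affine hne] at hsum
  rw [hsum, hRa, hRb]
  ring
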